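/- Let $(\Omega,\Sigma,\mu)$ and $(\Omega',\Sigma',\nu)$ be $\sigma$-finite measure spaces, $1 \le r_2 \le r_1 < 2$ and $1 \le q \le p < \infty$, and suppose there exists $t$ with $q \le t \le p$ and $r_1 < t \le 2$. Then there is a constant $C$ depending only on the exponents such that every bounded linear operator $T : L^{r_1}(\mu) \to L^{r_2}(\nu)$ is $(p,q)$-regular with constant $C\|T\|$. -/

import Mathlib

open MeasureTheory ENNReal

/-- `T` is `(p,q)`-regular with constant `K`. -/
def IsPQRegular {Ω Ω' : Type*} [MeasurableSpace Ω] [MeasurableSpace Ω']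
    {μ : Measure Ω} {ν : Measure Ω'} {u v : ℝ≥0∞}
    (T : Lp ℝ u μ → Lp ℝ v ν) (p q K : ℝ) : Prop :=
  ∀ (n : ℕ) (f : Fin n → Lp ℝ u μ),
    eLpNorm (fun ω' => (∑ i, |T (f i) ω'| ^ p) ^ (1 / p)) v ν ≤
      ENNReal.ofReal K * eLpNorm (fun ω => (∑ i, |f i ω| ^ q) ^ (1 / q)) u μ

/-- The sign `±1` encoded by a Boolean. -/
def boolSign (b : Bool) : ℝ := if b then 1 else -1

lemma sum_bool_fun_succ {n : ℕ} (F : (Fin (n + 1) → Bool) → ℝ) :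
    ∑ e, F e = ∑ e : Fin n → Bool,
      (F (Fin.cons true e : Fin (n + 1) → Bool) + F (Fin.cons false e : Fin (n + 1) → Bool)) := by
  rw [← (Fin.consEquiv (fun _ : Fin (n + 1) => Bool)).sum_comp, Fintype.sum_prod_type]
  simp [Fin.consEquiv, Finset.sum_add_distrib]

/-- Second moment of a Rademacher sum. -/
lemma sum_signs_sq {n : ℕ} (a : Fin n → ℝ) :
    ∑ e : Fin n → Bool, (∑ i, boolSign (e i) * a i) ^ 2 = 2 ^ n * ∑ i, a i ^ 2 := by
  induction n with
  | zero => simp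
  | succ n ih =>
    rw [sum_bool_fun_succ]
    simp only [Fin.sum_univ_succ, Fin.cons_zero, Fin.cons_succ, boolSign, if_true,
      Bool.false_eq_true, if_false]
    have h := ih (fun i => a i.succ)
    simp only [boolSign] at h
    have key : ∀ x : ℝ, (1 * a 0 + x) ^ 2 + (-1 * a 0 + x) ^ 2 = 2 * x ^ 2 + 2 * a 0 ^ 2 := by
      intro x; ring
    simp only [key, Finset.sum_add_distrib, ← Finset.mul_sum, h]
    simp
    ring

/-- Fourth moment of a Rademacher sum. -/
lemma sum_signs_pow_four_le {n : ℕ} (a : Fin n → ℝ) :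
    ∑ e : Fin n → Bool, (∑ i, boolSign (e i) * a i) ^ 4 ≤ 2 ^ n * (3 * (∑ i, a i ^ 2) ^ 2) := by
  induction n with
  | zero => simp
  | succ n ih =>
    rw [sum_bool_fun_succ]
    simp only [Fin.sum_univ_succ, Fin.cons_zero, Fin.cons_succ]
    have h := ih (fun i => a i.succ)
    have h2 := sum_signs_sq (fun i => a i.succ)
    have key : ∀ x : ℝ, (boolSign true * a 0 + x) ^ 4 + (boolSign false * a 0 + x) ^ 4
        = 2 * x ^ 4 + 12 * a 0 ^ 2 * x ^ 2 + 2 * a 0 ^ 4 := by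
      intro x; simp [boolSign]; ring
    simp only [key, Finset.sum_add_distrib, ← Finset.mul_sum, h2]
    simp only [Finset.sum_const, Finset.card_univ, Fintype.card_fun, Fintype.card_bool,
      Fintype.card_fin, nsmul_eq_mul, Nat.cast_pow, Nat.cast_ofNat]
    have h4 : 0 ≤ (2 : ℝ) ^ n * (a 0 ^ 4) := by positivity
    rw [pow_succ (2 : ℝ) n]
    nlinarith

lemma sq_sub_pow_four_le_rpow {r y : ℝ} (hr : 1 ≤ r) (hr2 : r ≤ 2) (hy : 0 ≤ y) :
    y ^ 2 - y ^ 4 / 6 ≤ y ^ r := by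
  rcases le_total y 1 with h | h
  · have : y ^ (2 : ℝ) ≤ y ^ r := by
      rcases hy.eq_or_lt with rfl | h0
      · rw [Real.zero_rpow (by norm_num), Real.zero_rpow (by linarith)]
      · exact Real.rpow_le_rpow_of_exponent_ge h0 h hr2
    rw [Real.rpow_two] at this
    have : 0 ≤ y ^ 4 := by positivity
    linarith
  · have : y ^ (1 : ℝ) ≤ y ^ r := Real.rpow_le_rpow_of_exponent_le h hr
    rw [Real.rpow_one] at this
    nlinarith [mul_nonneg hy (mul_nonneg (by linarith : 0 ≤ y + 3) (sq_nonneg (y - 3/2))),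
      mul_nonneg hy (sq_nonneg (y - 3/2)), mul_nonneg hy (sq_nonneg y)]

lemma rpow_le_one_add_sq {r y : ℝ} (hr : 1 ≤ r) (hr2 : r ≤ 2) (hy : 0 ≤ y) :
    y ^ r ≤ 1 + y ^ 2 := by
  rcases le_total y 1 with h | h
  · have := Real.rpow_le_one hy h (by linarith : 0 ≤ r)
    nlinarith
  · have : y ^ r ≤ y ^ (2 : ℝ) := Real.rpow_le_rpow_of_exponent_le h hr2
    rw [Real.rpow_two] at this
    linarith

/-- **Khinchine's inequality** for exponents in `[1, 2]`. -/
lemma khinchine {n : ℕ} {r : ℝ} (hr : 1 ≤ r) (hr2 : r ≤ 2) (a : Fin n → ℝ) :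
    2 ^ n * (∑ i, a i ^ 2) ^ (r / 2) ≤
        2 * ∑ e : Fin n → Bool, |∑ i, boolSign (e i) * a i| ^ r ∧
      ∑ e : Fin n → Bool, |∑ i, boolSign (e i) * a i| ^ r ≤
        2 * (2 ^ n * (∑ i, a i ^ 2) ^ (r / 2)) := by
  set V := ∑ i, a i ^ 2 with hV
  have hV0 : 0 ≤ V := Finset.sum_nonneg fun i _ => sq_nonneg _
  rcases hV0.eq_or_lt with h0 | hpos
  · have ha : ∀ i, a i = 0 := by
      intro i
      have := (Finset.sum_eq_zero_iff_of_nonneg (fun i _ => sq_nonneg (a i))).1 h0.symm i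
        (Finset.mem_univ i)
      exact pow_eq_zero_iff (two_ne_zero) |>.1 this
    simp [← h0, ha, Real.zero_rpow (by linarith : r ≠ 0), Real.zero_rpow (by linarith : r / 2 ≠ 0)]
  · set σ := √V with hσ
    have hσ0 : 0 < σ := Real.sqrt_pos.2 hpos
    have hσ2 : σ ^ 2 = V := Real.sq_sqrt hV0
    have hσr : V ^ (r / 2) = σ ^ r := by
      rw [← hσ2, ← Real.rpow_natCast, ← Real.rpow_mul hσ0.le]; congr 1; push_cast; ring
    have h2 := sum_signs_sq a
    have h4 := sum_signs_pow_four_le a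
    rw [← hV] at h2 h4
    have hscale : ∀ x : ℝ, |x| ^ r = σ ^ r * (|x| / σ) ^ r := by
      intro x
      rw [← Real.mul_rpow hσ0.le (by positivity), mul_div_cancel₀ _ hσ0.ne']
    have hσrp : 0 < σ ^ r := Real.rpow_pos_of_pos hσ0 r
    have hsum2 : ∑ e : Fin n → Bool, (|∑ i, boolSign (e i) * a i| / σ) ^ 2 = 2 ^ n := by
      simp only [div_pow, sq_abs, hσ2, ← Finset.sum_div, h2]
      field_simp
    have hsum4 : ∑ e : Fin n → Bool, (|∑ i, boolSign (e i) * a i| / σ) ^ 4 ≤ 2 ^ n * 3 := by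
      have h4' : σ ^ 4 = V ^ 2 := by rw [← hσ2]; ring
      have habs : ∀ x : ℝ, |x| ^ 4 = x ^ 4 := fun x => (by decide : Even 4).pow_abs x
      simp only [div_pow, habs, h4', ← Finset.sum_div]
      rw [div_le_iff₀ (by positivity)]
      linarith
    rw [hσr]
    simp only [hscale, ← Finset.mul_sum]
    constructor
    · have : ∑ e : Fin n → Bool, ((|∑ i, boolSign (e i) * a i| / σ) ^ 2
          - (|∑ i, boolSign (e i) * a i| / σ) ^ 4 / 6) ≤
          ∑ e : Fin n → Bool, (|∑ i, boolSign (e i) * a i| / σ) ^ r :=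
        Finset.sum_le_sum fun e _ => sq_sub_pow_four_le_rpow hr hr2 (by positivity)
      rw [Finset.sum_sub_distrib, ← Finset.sum_div, hsum2] at this
      nlinarith
    · have : ∑ e : Fin n → Bool, (|∑ i, boolSign (e i) * a i| / σ) ^ r ≤
          ∑ e : Fin n → Bool, (1 + (|∑ i, boolSign (e i) * a i| / σ) ^ 2) :=
        Finset.sum_le_sum fun e _ => rpow_le_one_add_sq hr hr2 (by positivity)
      rw [Finset.sum_add_distrib, hsum2] at this
      simp only [Finset.sum_const, Finset.card_univ, Fintype.card_fun, Fintype.card_bool,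
        Fintype.card_fin, nsmul_eq_mul, Nat.cast_pow, Nat.cast_ofNat, mul_one] at this
      nlinarith

lemma one_add_sum_rpow_le {ι : Type*} {ρ : ℝ} (h0 : 0 ≤ ρ) (h1 : ρ ≤ 1) (s : Finset ι)
    (x : ι → ℝ) (hx : ∀ i, 0 ≤ x i) :
    (1 + ∑ i ∈ s, x i) ^ ρ ≤ 1 + ∑ i ∈ s, min (x i) (x i ^ ρ) := by
  classical
  induction s using Finset.induction_on with
  | empty => simp
  | insert i s hi ih =>
    rw [Finset.sum_insert hi, Finset.sum_insert hi]
    set M := 1 + ∑ j ∈ s, x j with hM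
    have hM1 : 1 ≤ M := by
      have := Finset.sum_nonneg (s := s) fun j _ => hx j
      linarith
    have hxi := hx i
    have hsub : (M + x i) ^ ρ ≤ M ^ ρ + x i ^ ρ := Real.rpow_add_le_add_rpow (by linarith) hxi h0 h1
    have hlin : (M + x i) ^ ρ ≤ M ^ ρ + x i := by
      have hsplit : ∀ y : ℝ, 0 < y → y ^ ρ = y * y ^ (ρ - 1) := by
        intro y hy
        rw [Real.rpow_sub_one hy.ne', mul_div_cancel₀ _ hy.ne']
      rw [hsplit (M + x i) (by linarith), hsplit M (by linarith), add_mul]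
      have e1 : (M + x i) ^ (ρ - 1) ≤ M ^ (ρ - 1) :=
        Real.rpow_le_rpow_of_nonpos (by linarith) (by linarith) (by linarith)
      have e2 : (M + x i) ^ (ρ - 1) ≤ 1 :=
        Real.rpow_le_one_of_one_le_of_nonpos (by linarith) (by linarith)
      nlinarith
    have : (M + x i) ^ ρ ≤ M ^ ρ + min (x i) (x i ^ ρ) := by
      rcases min_choice (x i) (x i ^ ρ) with h | h <;> rw [h] <;> assumption
    have e : 1 + (x i + ∑ j ∈ s, x j) = M + x i := by rw [hM]; ring
    rw [e]
    linarith

lemma lintegral_min_rpow_lt_top {r t : ℝ} (hr : 0 < r) (hrt : r < t) (ht : t < 2) :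
    ∫⁻ v in Set.Ioi (0 : ℝ), ENNReal.ofReal
      (min ((v ^ (-(1 / t))) ^ 2) (((v ^ (-(1 / t))) ^ 2) ^ (r / 2))) < ∞ := by
  have ht0 : 0 < t := hr.trans hrt
  rw [← Set.Ioc_union_Ioi_eq_Ioi (zero_le_one' ℝ),
    lintegral_union measurableSet_Ioi Set.Ioc_disjoint_Ioi_same]
  refine ENNReal.add_lt_top.2 ⟨?_, ?_⟩
  · have hint : IntegrableOn (fun v : ℝ => v ^ (-(r / t))) (Set.Ioc 0 1) := by
      rw [← intervalIntegrable_iff_integrableOn_Ioc_of_le zero_le_one]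
      apply intervalIntegral.intervalIntegrable_rpow'
      have : r / t < 1 := (div_lt_one ht0).2 hrt
      linarith
    refine lt_of_le_of_lt (setLIntegral_mono' measurableSet_Ioc fun v hv => ?_)
      hint.lintegral_lt_top
    refine ENNReal.ofReal_le_ofReal ((min_le_right _ _).trans_eq ?_)
    rw [← Real.rpow_natCast, ← Real.rpow_mul hv.1.le, ← Real.rpow_mul hv.1.le]
    congr 1
    push_cast
    field_simp
  · have hint : IntegrableOn (fun v : ℝ => v ^ (-(2 / t))) (Set.Ioi 1) := by
      apply integrableOn_Ioi_rpow_of_lt _ zero_lt_one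
      have : 1 < 2 / t := (one_lt_div ht0).2 ht
      linarith
    refine lt_of_le_of_lt (setLIntegral_mono' measurableSet_Ioi fun v hv => ?_)
      hint.lintegral_lt_top
    have hv0 : (0 : ℝ) ≤ v := zero_le_one.trans (le_of_lt hv)
    refine ENNReal.ofReal_le_ofReal ((min_le_left _ _).trans_eq ?_)
    rw [← Real.rpow_natCast, ← Real.rpow_mul hv0]
    congr 1
    push_cast
    field_simp

lemma setLIntegral_Ioi_comp_mul_left (g : ℝ → ℝ≥0∞) (hg : Measurable g) {k : ℝ} (hk : 0 < k) :
    ∫⁻ u in Set.Ioi (0 : ℝ), g (k * u) = ENNReal.ofReal k⁻¹ * ∫⁻ u in Set.Ioi (0 : ℝ), g u := by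
  have h := lintegral_map (μ := volume) (f := (Set.Ioi (0 : ℝ)).indicator g)
    (hg.indicator measurableSet_Ioi) (measurable_const_mul k)
  rw [Real.map_volume_mul_left hk.ne', lintegral_smul_measure, abs_of_pos (inv_pos.2 hk),
    lintegral_indicator measurableSet_Ioi] at h
  rw [← smul_eq_mul, h, ← lintegral_indicator measurableSet_Ioi]
  congr 1
  ext u
  simp [Set.indicator, hk]

lemma lintegral_min_rpow_scaled_le {r t : ℝ} (hr : 0 < r) (hrt : r < t) (b : ℝ) :
    ∫⁻ u in Set.Ioc (0 : ℝ) 1, ENNReal.ofReal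
      (min ((u ^ (-(1 / t)) * b) ^ 2) (((u ^ (-(1 / t)) * b) ^ 2) ^ (r / 2))) ≤
    ENNReal.ofReal (|b| ^ t) * ∫⁻ v in Set.Ioi (0 : ℝ), ENNReal.ofReal
      (min ((v ^ (-(1 / t))) ^ 2) (((v ^ (-(1 / t))) ^ 2) ^ (r / 2))) := by
  have ht0 : 0 < t := hr.trans hrt
  rcases eq_or_ne b 0 with rfl | hb
  · simp [Real.zero_rpow (by linarith : r / 2 ≠ 0)]
  · have hb' : 0 < |b| := abs_pos.2 hb
    have hbt : 0 < |b| ^ t := Real.rpow_pos_of_pos hb' t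
    rw [← inv_inv (|b| ^ t), ← setLIntegral_Ioi_comp_mul_left
      (fun v : ℝ => ENNReal.ofReal
        (min ((v ^ (-(1 / t))) ^ 2) (((v ^ (-(1 / t))) ^ 2) ^ (r / 2)))) (by fun_prop)
      (inv_pos.2 hbt)]
    refine le_trans (lintegral_mono_set (Set.Ioc_subset_Ioi_self)) ?_
    refine (setLIntegral_congr_fun measurableSet_Ioi fun u hu => ?_).le
    have hu0 : (0 : ℝ) < u := hu
    have key : (((|b| ^ t)⁻¹ * u) ^ (-(1 / t))) ^ 2 = (u ^ (-(1 / t)) * b) ^ 2 := by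
      rw [Real.mul_rpow (by positivity) hu0.le, Real.inv_rpow hbt.le, Real.rpow_neg hbt.le,
        inv_inv, ← Real.rpow_mul hb'.le, mul_one_div_cancel ht0.ne', Real.rpow_one, mul_pow,
        mul_pow, sq_abs, mul_comm]
    simp only [key]

/-- The product of `n` copies of the uniform distribution on `(0, 1]`. -/
noncomputable def uniformCube (n : ℕ) : Measure (Fin n → ℝ) :=
  Measure.pi fun _ => volume.restrict (Set.Ioc (0 : ℝ) 1)

instance isProbabilityMeasure_volume_Ioc :
    IsProbabilityMeasure (volume.restrict (Set.Ioc (0 : ℝ) 1)) := ⟨by simp⟩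

instance isProbabilityMeasure_uniformCube (n : ℕ) : IsProbabilityMeasure (uniformCube n) := by
  unfold uniformCube; infer_instance

/-- Moments of sums of independent weights with a `t / 2`-Pareto tail: upper bound. -/
lemma lintegral_pareto_le {r t : ℝ} (hr : 0 < r) (hr2 : r ≤ 2) (hrt : r < t) {n : ℕ}
    (b : Fin n → ℝ) (hb : ∑ i, |b i| ^ t = 1) :
    ∫⁻ u, ENNReal.ofReal ((∑ i, (u i ^ (-(1 / t)) * b i) ^ 2) ^ (r / 2)) ∂(uniformCube n) ≤
      1 + ∫⁻ v in Set.Ioi (0 : ℝ), ENNReal.ofReal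
        (min ((v ^ (-(1 / t))) ^ 2) (((v ^ (-(1 / t))) ^ 2) ^ (r / 2))) := by
  set g : ℝ → ℝ → ℝ≥0∞ := fun b u => ENNReal.ofReal
    (min ((u ^ (-(1 / t)) * b) ^ 2) (((u ^ (-(1 / t)) * b) ^ 2) ^ (r / 2))) with hg
  have hgm : ∀ b, Measurable (g b) := fun b => by fun_prop
  have hnn : ∀ (u b : ℝ), 0 ≤ min ((u ^ (-(1 / t)) * b) ^ 2)
      (((u ^ (-(1 / t)) * b) ^ 2) ^ (r / 2)) := fun u b => by positivity
  calc _ ≤ ∫⁻ u, (1 + ∑ i, g (b i) (u i)) ∂(uniformCube n) := by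
        refine lintegral_mono fun u => ?_
        have hs : 0 ≤ ∑ i, (u i ^ (-(1 / t)) * b i) ^ 2 :=
          Finset.sum_nonneg fun i _ => sq_nonneg _
        have h := one_add_sum_rpow_le (ρ := r / 2) (by linarith) (by linarith) Finset.univ
          (fun i => (u i ^ (-(1 / t)) * b i) ^ 2) fun i => sq_nonneg _
        have h' := Real.rpow_le_rpow hs (le_add_of_nonneg_left zero_le_one)
          (by linarith : 0 ≤ r / 2)
        refine (ENNReal.ofReal_le_ofReal (h'.trans h)).trans_eq ?_
        rw [ENNReal.ofReal_add zero_le_one (Finset.sum_nonneg fun i _ => hnn _ _),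
          ENNReal.ofReal_sum_of_nonneg fun i _ => hnn _ _, ENNReal.ofReal_one]
    _ = 1 + ∑ i, ∫⁻ u in Set.Ioc (0 : ℝ) 1, g (b i) u := by
        rw [lintegral_add_left measurable_const, lintegral_finsetSum _ fun i _ =>
          by exact (hgm (b i)).comp (measurable_pi_apply i)]
        simp only [lintegral_const, measure_univ, mul_one]
        congr 1
        refine Finset.sum_congr rfl fun i _ => ?_
        exact (measurePreserving_eval (fun _ : Fin n => volume.restrict (Set.Ioc (0 : ℝ) 1))
          i).lintegral_comp (hgm (b i))
    _ ≤ 1 + ∑ i, ENNReal.ofReal (|b i| ^ t) * _ := by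
        gcongr with i _
        exact lintegral_min_rpow_scaled_le hr hrt (b i)
    _ = _ := by
        rw [← Finset.sum_mul, ← ENNReal.ofReal_sum_of_nonneg fun i _ => by positivity, hb,
          ENNReal.ofReal_one, one_mul]

/-- Moments of sums of independent weights with a `t / 2`-Pareto tail: lower bound. -/
lemma one_le_two_mul_lintegral_pareto {r t : ℝ} (hr : 0 < r) (ht : 0 < t) {n : ℕ}
    (b : Fin n → ℝ) (hb : ∑ i, |b i| ^ t = 1) :
    1 ≤ 2 * ∫⁻ u, ENNReal.ofReal ((∑ i, (u i ^ (-(1 / t)) * b i) ^ 2) ^ (r / 2))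
      ∂(uniformCube n) := by
  set A : Set (Fin n → ℝ) := Set.univ.pi fun i => {u : ℝ | 0 < u → |b i| ^ t < u} with hA
  have hAm : MeasurableSet A := by
    refine MeasurableSet.univ_pi fun i => ?_
    have : {u : ℝ | 0 < u → |b i| ^ t < u} = Set.Iic 0 ∪ Set.Ioi (|b i| ^ t) := by
      ext u
      simp only [Set.mem_ofPred_eq, Set.mem_union, Set.mem_Iic, Set.mem_Ioi]
      rw [imp_iff_not_or, not_lt]
    rw [this]
    measurability
  have hAle : uniformCube n A ≤ 1 / 2 := by
    rw [uniformCube, hA, Measure.pi_pi]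
    have h1 : ∀ i, (volume.restrict (Set.Ioc (0 : ℝ) 1)) {u : ℝ | 0 < u → |b i| ^ t < u} ≤
        ENNReal.ofReal (Real.exp (-(|b i| ^ t))) := by
      intro i
      rw [Measure.restrict_apply' measurableSet_Ioc]
      refine (measure_mono (t := Set.Ioc (|b i| ^ t) 1) ?_).trans ?_
      · rintro u ⟨h, h0, h1⟩
        exact ⟨h h0, h1⟩
      · rw [Real.volume_Ioc]
        exact ENNReal.ofReal_le_ofReal (by linarith [Real.add_one_le_exp (-(|b i| ^ t))])
    refine (Finset.prod_le_prod' fun i _ => h1 i).trans ?_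
    rw [← ENNReal.ofReal_prod_of_nonneg fun i _ => (Real.exp_pos _).le, ← Real.exp_sum,
      Finset.sum_neg_distrib, hb]
    have : Real.exp (-1) ≤ 1 / 2 := by
      rw [Real.exp_neg, one_div]
      exact inv_anti₀ two_pos (by linarith [Real.add_one_le_exp 1])
    refine (ENNReal.ofReal_le_ofReal this).trans_eq ?_
    rw [ENNReal.ofReal_div_of_pos two_pos]; simp
  have hge : uniformCube n Aᶜ ≤
      ∫⁻ u, ENNReal.ofReal ((∑ i, (u i ^ (-(1 / t)) * b i) ^ 2) ^ (r / 2)) ∂(uniformCube n) := by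
    rw [← lintegral_indicator_one hAm.compl]
    refine lintegral_mono fun u => ?_
    by_cases hu : u ∈ Aᶜ
    · rw [Set.indicator_of_mem hu, Pi.one_apply, ← ENNReal.ofReal_one]
      refine ENNReal.ofReal_le_ofReal (Real.one_le_rpow ?_ (by linarith))
      simp only [hA, Set.mem_compl_iff, Set.mem_pi, Set.mem_univ, true_implies,
        Set.mem_ofPred_eq, not_forall, not_lt] at hu
      obtain ⟨i, h0, hi⟩ := hu
      refine le_trans ?_ (Finset.single_le_sum
        (f := fun i => (u i ^ (-(1 / t)) * b i) ^ 2) (fun j _ => sq_nonneg _) (Finset.mem_univ i))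
      have : u i ^ (1 / t) ≤ |b i| := by
        have := Real.rpow_le_rpow h0.le hi (by positivity : 0 ≤ 1 / t)
        rwa [← Real.rpow_mul (abs_nonneg _), mul_one_div_cancel ht.ne', Real.rpow_one] at this
      have hpos : 0 < u i ^ (1 / t) := Real.rpow_pos_of_pos h0 _
      rw [one_le_sq_iff_one_le_abs, abs_mul, Real.rpow_neg h0.le, abs_inv, abs_of_pos hpos,
        inv_mul_eq_div]
      exact (one_le_div hpos).2 this
    · rw [Set.indicator_of_notMem hu]; exact zero_le
  have : (1 : ℝ≥0∞) / 2 ≤ uniformCube n Aᶜ := by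
    have h2 : (1 : ℝ≥0∞) / 2 + 1 / 2 ≤ 1 / 2 + uniformCube n Aᶜ :=
      ((ENNReal.add_halves 1).trans (prob_add_prob_compl hAm).symm).trans_le (by gcongr)
    exact (ENNReal.add_le_add_iff_left (by simp)).1 h2
  calc (1 : ℝ≥0∞) = 2 * (1 / 2) := by rw [ENNReal.mul_div_cancel] <;> simp
    _ ≤ _ := by gcongr; exact this.trans hge

/-- There are random weights whose weighted `ℓ²`-norms have moments comparable to the
`ℓᵗ`-norm. -/
lemma exists_square_weights {r₁ r₂ t : ℝ} (h₁ : 0 < r₁) (h₂ : 0 < r₂) (h₁t : r₁ < t)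
    (ht : t ≤ 2) :
    ∃ C : ℝ≥0∞, C ≠ ∞ ∧ ∀ n : ℕ, ∃ Q : Measure (Fin n → ℝ), IsProbabilityMeasure Q ∧
      ∀ b : Fin n → ℝ,
        ENNReal.ofReal ((∑ i, |b i| ^ t) ^ (r₂ / t)) ≤
            C * ∫⁻ w, ENNReal.ofReal ((∑ i, (w i * b i) ^ 2) ^ (r₂ / 2)) ∂Q ∧
          ∫⁻ w, ENNReal.ofReal ((∑ i, (w i * b i) ^ 2) ^ (r₁ / 2)) ∂Q ≤
            C * ENNReal.ofReal ((∑ i, |b i| ^ t) ^ (r₁ / t)) := by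
  have ht0 : 0 < t := h₁.trans h₁t
  rcases ht.eq_or_lt with rfl | ht2
  · refine ⟨1, one_ne_top, fun n => ⟨Measure.dirac 1, inferInstance, fun b => ?_⟩⟩
    have hm : ∀ r : ℝ, Measurable fun w : Fin n → ℝ =>
        ENNReal.ofReal ((∑ i, (w i * b i) ^ 2) ^ (r / 2)) := fun r => by fun_prop
    rw [lintegral_dirac' _ (hm _), lintegral_dirac' _ (hm _)]
    simp
  · set I := ∫⁻ v in Set.Ioi (0 : ℝ), ENNReal.ofReal
      (min ((v ^ (-(1 / t))) ^ 2) (((v ^ (-(1 / t))) ^ 2) ^ (r₁ / 2))) with hI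
    have hIt : I < ∞ := lintegral_min_rpow_lt_top h₁ h₁t ht2
    refine ⟨2 + I, by finiteness, fun n => ⟨(uniformCube n).map fun u i => u i ^ (-(1 / t)),
      Measure.isProbabilityMeasure_map
        (Measurable.aemeasurable (by fun_prop)), fun b => ?_⟩⟩
    have hm : ∀ r : ℝ, Measurable fun w : Fin n → ℝ =>
        ENNReal.ofReal ((∑ i, (w i * b i) ^ 2) ^ (r / 2)) := fun r => by fun_prop
    have hu : Measurable fun (u : Fin n → ℝ) i => u i ^ (-(1 / t)) := by fun_prop
    rw [lintegral_map (hm _) hu, lintegral_map (hm _) hu]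
    have hN0 : 0 ≤ ∑ i, |b i| ^ t := Finset.sum_nonneg fun i _ => by positivity
    rcases hN0.eq_or_lt with h0 | hpos
    · have hb : ∀ i, b i = 0 := by
        intro i
        have := (Finset.sum_eq_zero_iff_of_nonneg
          (fun i _ => Real.rpow_nonneg (abs_nonneg (b i)) t)).1 h0.symm i (Finset.mem_univ i)
        exact abs_eq_zero.1 ((Real.rpow_eq_zero (abs_nonneg _) ht0.ne').1 this)
      rw [← h0]
      simp [hb, Real.zero_rpow (by positivity : r₁ / 2 ≠ 0),
        Real.zero_rpow (by positivity : r₂ / t ≠ 0)]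
    · set N := ∑ i, |b i| ^ t with hN
      have hσ : 0 < N ^ (1 / t) := Real.rpow_pos_of_pos hpos _
      set σ := N ^ (1 / t) with hσdef
      have hσr : ∀ r, N ^ (r / t) = σ ^ r := by
        intro r
        rw [hσdef, ← Real.rpow_mul hpos.le]; congr 1; ring
      have hσt : σ ^ t = N := by
        rw [hσdef, ← Real.rpow_mul hpos.le, one_div_mul_cancel ht0.ne', Real.rpow_one]
      have hunit : ∑ i, |b i / σ| ^ t = 1 := by
        simp only [abs_div, abs_of_pos hσ, Real.div_rpow (abs_nonneg _) hσ.le, hσt,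
          ← Finset.sum_div, ← hN]
        exact div_self hpos.ne'
      have hscale : ∀ (r : ℝ),
          ∫⁻ u, ENNReal.ofReal ((∑ i, (u i ^ (-(1 / t)) * b i) ^ 2) ^ (r / 2)) ∂(uniformCube n) =
          ENNReal.ofReal (σ ^ r) * ∫⁻ u, ENNReal.ofReal
            ((∑ i, (u i ^ (-(1 / t)) * (b i / σ)) ^ 2) ^ (r / 2)) ∂(uniformCube n) := by
        intro r
        rw [← lintegral_const_mul _ (by fun_prop)]
        congr 1
        ext u
        rw [← ENNReal.ofReal_mul (by positivity)]
        have e1 : σ ^ r = (σ ^ 2) ^ (r / 2) := by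
          rw [← Real.rpow_natCast, ← Real.rpow_mul hσ.le]; congr 1; push_cast; ring
        rw [e1, ← Real.mul_rpow (by positivity) (Finset.sum_nonneg fun i _ => sq_nonneg _),
          Finset.mul_sum]
        congr 3
        ext i
        field_simp
      rw [hscale, hscale, hσr, hσr]
      constructor
      · have h := one_le_two_mul_lintegral_pareto h₂ ht0 _ hunit
        calc ENNReal.ofReal (σ ^ r₂) = ENNReal.ofReal (σ ^ r₂) * 1 := (mul_one _).symm
          _ ≤ ENNReal.ofReal (σ ^ r₂) * ((2 + I) * _) := by
            gcongr
            refine h.trans ?_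
            gcongr
            exact le_self_add
          _ = _ := by ring
      · have h := lintegral_pareto_le h₁ (by linarith) h₁t _ hunit
        rw [mul_comm (2 + I)]
        gcongr
        refine h.trans ?_
        rw [← hI]
        gcongr
        exact one_le_two

/-- There are random weights `θ` such that the moments of `∑ i, θ i * b i` are comparable to the
`ℓᵗ`-norm of `b`. -/
lemma exists_random_weights {r₁ r₂ t : ℝ} (h₁ : 1 ≤ r₁) (h₂ : 1 ≤ r₂) (h₁t : r₁ < t)
    (h₂t : r₂ ≤ 2) (ht : t ≤ 2) :
    ∃ C : ℝ≥0∞, C ≠ ∞ ∧ ∀ n : ℕ, ∃ P : Measure (Fin n → ℝ), IsProbabilityMeasure P ∧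
      ∀ b : Fin n → ℝ,
        ENNReal.ofReal ((∑ i, |b i| ^ t) ^ (r₂ / t)) ≤
            C * ∫⁻ θ, ENNReal.ofReal (|∑ i, θ i * b i| ^ r₂) ∂P ∧
          ∫⁻ θ, ENNReal.ofReal (|∑ i, θ i * b i| ^ r₁) ∂P ≤
            C * ENNReal.ofReal ((∑ i, |b i| ^ t) ^ (r₁ / t)) := by
  obtain ⟨C, hC, h⟩ := exists_square_weights (by linarith : 0 < r₁) (by linarith : 0 < r₂) h₁t ht
  refine ⟨C * 2, by finiteness, fun n => ?_⟩
  obtain ⟨Q, hQ, hb⟩ := h n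
  let S : Measure (Fin n → Bool) := (ENNReal.ofReal (2 ^ n))⁻¹ • Measure.count
  have h2n : ENNReal.ofReal (2 ^ n) ≠ 0 := by simp
  have hS : ∀ F : (Fin n → Bool) → ℝ, (∀ e, 0 ≤ F e) →
      ∫⁻ e, ENNReal.ofReal (F e) ∂S = (ENNReal.ofReal (2 ^ n))⁻¹ * ENNReal.ofReal (∑ e, F e) := by
    intro F hF
    simp only [S]
    rw [lintegral_smul_measure, lintegral_count, tsum_fintype, smul_eq_mul,
      ENNReal.ofReal_sum_of_nonneg fun e _ => hF e]
  have hSp : IsProbabilityMeasure S := by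
    constructor
    have := hS (fun _ => 1) fun _ => zero_le_one
    rw [lintegral_const] at this
    simp only [ENNReal.ofReal_one, one_mul] at this
    rw [this]
    simp only [Finset.sum_const, Finset.card_univ, Fintype.card_fun, Fintype.card_bool,
      Fintype.card_fin, nsmul_eq_mul, Nat.cast_pow, Nat.cast_ofNat, mul_one]
    exact ENNReal.inv_mul_cancel h2n ofReal_ne_top
  have hsm : Measurable fun x : (Fin n → Bool) × (Fin n → ℝ) =>
      fun i => boolSign (x.1 i) * x.2 i := by
    refine measurable_pi_lambda _ fun i => ?_
    exact ((measurable_of_countable boolSign).comp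
      ((measurable_pi_apply i).comp measurable_fst)).mul
      ((measurable_pi_apply i).comp measurable_snd)
  refine ⟨(S.prod Q).map fun x i => boolSign (x.1 i) * x.2 i,
    Measure.isProbabilityMeasure_map hsm.aemeasurable, fun b => ?_⟩
  have hint : ∀ r : ℝ, ∫⁻ θ, ENNReal.ofReal (|∑ i, θ i * b i| ^ r)
      ∂((S.prod Q).map fun x i => boolSign (x.1 i) * x.2 i) =
      ∫⁻ w, (ENNReal.ofReal (2 ^ n))⁻¹ * ENNReal.ofReal
        (∑ e : Fin n → Bool, |∑ i, boolSign (e i) * (w i * b i)| ^ r) ∂Q := by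
    intro r
    have hm : Measurable fun θ : Fin n → ℝ => ENNReal.ofReal (|∑ i, θ i * b i| ^ r) := by
      fun_prop
    rw [lintegral_map hm hsm, lintegral_prod_symm _ (by exact (hm.comp hsm).aemeasurable)]
    refine lintegral_congr fun w => ?_
    rw [← hS _ fun e => by positivity]
    simp only [mul_assoc]
  have hcancel : ∀ x : ℝ, (ENNReal.ofReal (2 ^ n))⁻¹ * ENNReal.ofReal (2 ^ n * x) =
      ENNReal.ofReal x := by
    intro x
    rw [ENNReal.ofReal_mul (by positivity), ← mul_assoc, ENNReal.inv_mul_cancel h2n ofReal_ne_top,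
      one_mul]
  rw [hint, hint]
  constructor
  · refine (hb b).1.trans ?_
    rw [mul_assoc]
    gcongr
    rw [← lintegral_const_mul _ (by fun_prop)]
    refine lintegral_mono fun w => ?_
    have hk := (khinchine h₂ h₂t fun i => w i * b i).1
    rw [← hcancel ((∑ i, (w i * b i) ^ 2) ^ _), mul_left_comm]
    gcongr
    refine (ENNReal.ofReal_le_ofReal hk).trans_eq ?_
    rw [ENNReal.ofReal_mul zero_le_two, ENNReal.ofReal_ofNat]
  · rw [mul_comm C 2, mul_assoc]
    refine le_trans ?_ (mul_le_mul_right (hb b).2 2)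
    rw [← lintegral_const_mul _ (by fun_prop)]
    refine lintegral_mono fun w => ?_
    have hk := (khinchine h₁ (by linarith) fun i => w i * b i).2
    rw [← hcancel ((∑ i, (w i * b i) ^ 2) ^ _), mul_left_comm]
    gcongr
    refine (ENNReal.ofReal_le_ofReal hk).trans_eq ?_
    rw [ENNReal.ofReal_mul zero_le_two, ENNReal.ofReal_ofNat]

lemma rpow_sum_rpow_antitone {ι : Type*} (s : Finset ι) (x : ι → ℝ) {t p : ℝ} (ht : 0 < t)
    (htp : t ≤ p) :
    (∑ i ∈ s, |x i| ^ p) ^ (1 / p) ≤ (∑ i ∈ s, |x i| ^ t) ^ (1 / t) := by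
  have hp : 0 < p := ht.trans_le htp
  have hterm : ∀ q : ℝ, ∀ i ∈ s, 0 ≤ |x i| ^ q := fun q i _ => by positivity
  set N := ∑ i ∈ s, |x i| ^ t with hN
  have hN0 : 0 ≤ N := Finset.sum_nonneg (hterm t)
  have hx : ∀ i ∈ s, |x i| ≤ N ^ (1 / t) := by
    intro i hi
    have := Real.rpow_le_rpow (hterm t i hi) (Finset.single_le_sum (hterm t) hi)
      (by positivity : 0 ≤ 1 / t)
    rwa [← Real.rpow_mul (abs_nonneg _), mul_one_div_cancel ht.ne', Real.rpow_one] at this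
  have hsum : ∑ i ∈ s, |x i| ^ p ≤ (N ^ (1 / t)) ^ p := by
    calc ∑ i ∈ s, |x i| ^ p = ∑ i ∈ s, |x i| ^ t * |x i| ^ (p - t) := by
          refine Finset.sum_congr rfl fun i _ => ?_
          rw [← Real.rpow_add_of_nonneg (abs_nonneg _) ht.le (by linarith)]
          congr 1
          ring
      _ ≤ ∑ i ∈ s, |x i| ^ t * (N ^ (1 / t)) ^ (p - t) := by
          refine Finset.sum_le_sum fun i hi => ?_
          exact mul_le_mul_of_nonneg_left
            (Real.rpow_le_rpow (abs_nonneg _) (hx i hi) (by linarith)) (hterm t i hi)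
      _ = (N ^ (1 / t)) ^ t * (N ^ (1 / t)) ^ (p - t) := by
          rw [← Finset.sum_mul, ← hN, ← Real.rpow_mul hN0 (1 / t) t,
            one_div_mul_cancel ht.ne', Real.rpow_one]
      _ = (N ^ (1 / t)) ^ p := by
          rw [← Real.rpow_add_of_nonneg (by positivity) ht.le (by linarith)]
          congr 1
          ring
  have := Real.rpow_le_rpow (Finset.sum_nonneg (hterm p)) hsum (by positivity : 0 ≤ 1 / p)
  rwa [← Real.rpow_mul (by positivity), mul_one_div_cancel hp.ne', Real.rpow_one] at this

lemma eLpNorm_ofReal_eq {α : Type*} [MeasurableSpace α] {μ : Measure α} {r : ℝ} (hr : 0 < r)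
    (f : α → ℝ) :
    eLpNorm f (ENNReal.ofReal r) μ = (∫⁻ x, ENNReal.ofReal (|f x| ^ r) ∂μ) ^ (1 / r) := by
  rw [eLpNorm_eq_lintegral_rpow_enorm_toReal (by simpa using hr) ofReal_ne_top,
    ENNReal.toReal_ofReal hr.le]
  congr 1
  refine lintegral_congr fun x => ?_
  rw [← ofReal_norm, Real.norm_eq_abs,
    ENNReal.ofReal_rpow_of_nonneg (abs_nonneg _) hr.le]

lemma eLpNorm_rpow_sum_eq {α : Type*} [MeasurableSpace α] {μ : Measure α} {r t : ℝ} (hr : 0 < r)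
    {n : ℕ} (f : Fin n → α → ℝ) :
    eLpNorm (fun x => (∑ i, |f i x| ^ t) ^ (1 / t)) (ENNReal.ofReal r) μ =
      (∫⁻ x, ENNReal.ofReal ((∑ i, |f i x| ^ t) ^ (r / t)) ∂μ) ^ (1 / r) := by
  rw [eLpNorm_ofReal_eq hr]
  congr 1
  refine lintegral_congr fun x => ?_
  have h0 : 0 ≤ ∑ i, |f i x| ^ t := Finset.sum_nonneg fun i _ => by positivity
  rw [abs_of_nonneg (by positivity), ← Real.rpow_mul h0]
  congr 2
  ring

lemma eLpNorm_rpow_sum_antitone {α : Type*} [MeasurableSpace α] {μ : Measure α} {u : ℝ≥0∞}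
    {t p : ℝ} (ht : 0 < t) (htp : t ≤ p) {n : ℕ} (f : Fin n → α → ℝ) :
    eLpNorm (fun x => (∑ i, |f i x| ^ p) ^ (1 / p)) u μ ≤
      eLpNorm (fun x => (∑ i, |f i x| ^ t) ^ (1 / t)) u μ := by
  refine eLpNorm_mono fun x => ?_
  have h0 : ∀ q : ℝ, 0 ≤ (∑ i, |f i x| ^ q) ^ (1 / q) := fun q =>
    Real.rpow_nonneg (Finset.sum_nonneg fun i _ => by positivity) _
  rw [Real.norm_of_nonneg (h0 _), Real.norm_of_nonneg (h0 _)]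
  exact rpow_sum_rpow_antitone _ _ ht htp

/-- Jensen's inequality for the concave function `x ↦ x ^ s`. -/
lemma lintegral_rpow_le_rpow_lintegral {α : Type*} [MeasurableSpace α] {P : Measure α}
    [IsProbabilityMeasure P] {s : ℝ} (h0 : 0 < s) (h1 : s ≤ 1) {X : α → ℝ≥0∞}
    (hX : Measurable X) :
    ∫⁻ x, X x ^ s ∂P ≤ (∫⁻ x, X x ∂P) ^ s := by
  have h := eLpNorm'_le_eLpNorm'_of_exponent_le h0 h1 P hX.aestronglyMeasurable
  simp only [eLpNorm', enorm_eq_self, ENNReal.rpow_one, div_one] at h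
  have := ENNReal.rpow_le_rpow h h0.le
  rwa [← ENNReal.rpow_mul, one_div_mul_cancel h0.ne', ENNReal.rpow_one] at this

section Transfer

variable {Ω Ω' : Type*} [MeasurableSpace Ω] [MeasurableSpace Ω'] {μ : Measure Ω} {ν : Measure Ω'}

lemma Lp_coeFn_sum_smul {u : ℝ≥0∞} {n : ℕ} (f : Fin n → Lp ℝ u μ) (θ : Fin n → ℝ) :
    ⇑(∑ i, θ i • f i) =ᵐ[μ] fun ω => ∑ i, θ i * f i ω := by
  have h : ∀ᵐ ω ∂μ, ∀ i, (θ i • f i : Lp ℝ u μ) ω = θ i * f i ω := by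
    rw [ae_all_iff]
    intro i
    filter_upwards [Lp.coeFn_smul (θ i) (f i)] with ω hω
    simpa using hω
  filter_upwards [Lp.coeFn_finsetSum Finset.univ fun i => θ i • f i, h] with ω h1 h2
  rw [h1, Finset.sum_apply]
  exact Finset.sum_congr rfl fun i _ => h2 i

lemma lintegral_map_sum_smul_le {r₁ r₂ : ℝ} (h₁ : 0 < r₁) (h₂ : 0 < r₂)
    [Fact (1 ≤ ENNReal.ofReal r₁)] [Fact (1 ≤ ENNReal.ofReal r₂)]
    (T : Lp ℝ (ENNReal.ofReal r₁) μ →L[ℝ] Lp ℝ (ENNReal.ofReal r₂) ν) {n : ℕ}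
    (f : Fin n → Lp ℝ (ENNReal.ofReal r₁) μ) (θ : Fin n → ℝ) :
    ∫⁻ ω', ENNReal.ofReal (|∑ i, θ i * T (f i) ω'| ^ r₂) ∂ν ≤
      ‖T‖ₑ ^ r₂ * (∫⁻ ω, ENNReal.ofReal (|∑ i, θ i * f i ω| ^ r₁) ∂μ) ^ (r₂ / r₁) := by
  have h := T.le_opENorm (∑ i, θ i • f i)
  have hT : T (∑ i, θ i • f i) = ∑ i, θ i • T (f i) := by simp
  rw [hT, Lp.enorm_def, Lp.enorm_def, eLpNorm_congr_ae (Lp_coeFn_sum_smul _ _),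
    eLpNorm_congr_ae (Lp_coeFn_sum_smul _ _), eLpNorm_ofReal_eq h₁, eLpNorm_ofReal_eq h₂] at h
  have := ENNReal.rpow_le_rpow h h₂.le
  rwa [ENNReal.mul_rpow_of_nonneg _ _ h₂.le, ← ENNReal.rpow_mul, ← ENNReal.rpow_mul,
    one_div_mul_cancel h₂.ne', ENNReal.rpow_one, one_div_mul_eq_div] at this

lemma measurable_random_sum {n : ℕ} {u : ℝ≥0∞} (f : Fin n → Lp ℝ u μ) (r : ℝ) :
    Measurable fun x : Ω × (Fin n → ℝ) => ENNReal.ofReal (|∑ i, x.2 i * f i x.1| ^ r) := by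
  have hf : ∀ i, Measurable (f i) := fun i => (Lp.stronglyMeasurable (f i)).measurable
  fun_prop

lemma eLpNorm_map_le_of_weights [SFinite μ] [SFinite ν] {r₁ r₂ t : ℝ} (h₂ : 0 < r₂)
    (h₂₁ : r₂ ≤ r₁) [Fact (1 ≤ ENNReal.ofReal r₁)] [Fact (1 ≤ ENNReal.ofReal r₂)]
    (T : Lp ℝ (ENNReal.ofReal r₁) μ →L[ℝ] Lp ℝ (ENNReal.ofReal r₂) ν) {n : ℕ}
    (f : Fin n → Lp ℝ (ENNReal.ofReal r₁) μ) {P : Measure (Fin n → ℝ)} [IsProbabilityMeasure P]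
    {C : ℝ≥0∞}
    (hP : ∀ b : Fin n → ℝ,
      ENNReal.ofReal ((∑ i, |b i| ^ t) ^ (r₂ / t)) ≤
          C * ∫⁻ θ, ENNReal.ofReal (|∑ i, θ i * b i| ^ r₂) ∂P ∧
        ∫⁻ θ, ENNReal.ofReal (|∑ i, θ i * b i| ^ r₁) ∂P ≤
          C * ENNReal.ofReal ((∑ i, |b i| ^ t) ^ (r₁ / t))) :
    eLpNorm (fun ω' => (∑ i, |T (f i) ω'| ^ t) ^ (1 / t)) (ENNReal.ofReal r₂) ν ≤
      C ^ (1 / r₂) * C ^ (1 / r₁) * ‖T‖ₑ *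
        eLpNorm (fun ω => (∑ i, |f i ω| ^ t) ^ (1 / t)) (ENNReal.ofReal r₁) μ := by
  have h₁ : 0 < r₁ := h₂.trans_le h₂₁
  have hf : ∀ i, Measurable (f i) := fun i => (Lp.stronglyMeasurable (f i)).measurable
  have hm₁ := measurable_random_sum f r₁
  have hm₂ := measurable_random_sum (fun i => T (f i)) r₂
  rw [eLpNorm_rpow_sum_eq h₁, eLpNorm_rpow_sum_eq h₂]
  have key : ∫⁻ ω', ENNReal.ofReal ((∑ i, |T (f i) ω'| ^ t) ^ (r₂ / t)) ∂ν ≤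
      C * (‖T‖ₑ ^ r₂ *
        (C * ∫⁻ ω, ENNReal.ofReal ((∑ i, |f i ω| ^ t) ^ (r₁ / t)) ∂μ) ^ (r₂ / r₁)) := by
    calc ∫⁻ ω', ENNReal.ofReal ((∑ i, |T (f i) ω'| ^ t) ^ (r₂ / t)) ∂ν
        ≤ ∫⁻ ω', C * ∫⁻ θ, ENNReal.ofReal (|∑ i, θ i * T (f i) ω'| ^ r₂) ∂P ∂ν :=
          lintegral_mono fun ω' => (hP _).1
      _ = C * ∫⁻ θ, ∫⁻ ω', ENNReal.ofReal (|∑ i, θ i * T (f i) ω'| ^ r₂) ∂ν ∂P := by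
          rw [lintegral_const_mul _ hm₂.lintegral_prod_right',
            lintegral_lintegral_swap hm₂.aemeasurable]
      _ ≤ C * ∫⁻ θ, ‖T‖ₑ ^ r₂ *
            (∫⁻ ω, ENNReal.ofReal (|∑ i, θ i * f i ω| ^ r₁) ∂μ) ^ (r₂ / r₁) ∂P := by
          gcongr with θ
          exact lintegral_map_sum_smul_le h₁ h₂ T f θ
      _ = C * (‖T‖ₑ ^ r₂ *
            ∫⁻ θ, (∫⁻ ω, ENNReal.ofReal (|∑ i, θ i * f i ω| ^ r₁) ∂μ) ^ (r₂ / r₁) ∂P) := by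
          rw [lintegral_const_mul _ (hm₁.lintegral_prod_left'.pow_const _)]
      _ ≤ C * (‖T‖ₑ ^ r₂ *
            (∫⁻ θ, ∫⁻ ω, ENNReal.ofReal (|∑ i, θ i * f i ω| ^ r₁) ∂μ ∂P) ^ (r₂ / r₁)) := by
          gcongr
          exact lintegral_rpow_le_rpow_lintegral (by positivity) ((div_le_one h₁).2 h₂₁)
            hm₁.lintegral_prod_left'
      _ = C * (‖T‖ₑ ^ r₂ *
            (∫⁻ ω, ∫⁻ θ, ENNReal.ofReal (|∑ i, θ i * f i ω| ^ r₁) ∂P ∂μ) ^ (r₂ / r₁)) := by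
          exact congrArg (fun y => C * (‖T‖ₑ ^ r₂ * y ^ (r₂ / r₁)))
            (lintegral_lintegral_swap hm₁.aemeasurable).symm
      _ ≤ _ := by
          rw [← lintegral_const_mul _ (by fun_prop)]
          gcongr with ω
          exact (hP _).2
  refine (ENNReal.rpow_le_rpow key (by positivity : 0 ≤ 1 / r₂)).trans_eq ?_
  have h₂' : 0 ≤ 1 / r₂ := by positivity
  have e : r₂ / r₁ * (1 / r₂) = 1 / r₁ := by field_simp
  rw [ENNReal.mul_rpow_of_nonneg _ _ h₂', ENNReal.mul_rpow_of_nonneg _ _ h₂', ← ENNReal.rpow_mul,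
    ← ENNReal.rpow_mul, mul_one_div_cancel h₂.ne', ENNReal.rpow_one, e,
    ENNReal.mul_rpow_of_nonneg _ _ (by positivity)]
  ring

end Transfer

/-- For `1 ≤ r₂ ≤ r₁ < 2`, `1 ≤ q ≤ p < ∞`, if there is `t` with `q ≤ t ≤ p`
and `r₁ < t ≤ 2`, then there is a constant `C` depending only on the exponents
such that every bounded operator `T : L^{r₁}(μ) → L^{r₂}(ν)` is
`(p,q)`-regular with constant `C‖T‖`. -/
theorem stmt15 (p q r₁ r₂ : ℝ) (hr₂ : 1 ≤ r₂) (hr₂₁ : r₂ ≤ r₁) (hr₁ : r₁ < 2)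
    (hq : 1 ≤ q) (hqp : q ≤ p)
    (ht : ∃ t : ℝ, q ≤ t ∧ t ≤ p ∧ r₁ < t ∧ t ≤ 2)
    [Fact (1 ≤ ENNReal.ofReal r₁)] [Fact (1 ≤ ENNReal.ofReal r₂)] :
    ∃ C : ℝ,
      ∀ (Ω : Type*) (Ω' : Type*) [MeasurableSpace Ω] [MeasurableSpace Ω']
        (μ : Measure Ω) (ν : Measure Ω') [SigmaFinite μ] [SigmaFinite ν]
        (T : Lp ℝ (ENNReal.ofReal r₁) μ →L[ℝ] Lp ℝ (ENNReal.ofReal r₂) ν),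
        IsPQRegular (⇑T) p q (C * ‖T‖) := by
  obtain ⟨t, hqt, htp, hrt, ht2⟩ := ht
  have ht0 : 0 < t := by linarith
  obtain ⟨C, hC, h⟩ := exists_random_weights (hr₂.trans hr₂₁) hr₂ hrt (by linarith) ht2
  have hCt : C ^ (1 / r₂) * C ^ (1 / r₁) ≠ ∞ :=
    mul_ne_top (rpow_ne_top_of_nonneg (one_div_nonneg.2 (by linarith)) hC)
      (rpow_ne_top_of_nonneg (one_div_nonneg.2 (by linarith)) hC)
  refine ⟨(C ^ (1 / r₂) * C ^ (1 / r₁)).toReal, ?_⟩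
  intro Ω Ω' _ _ μ ν _ _ T n f
  obtain ⟨P, hPp, hP⟩ := h n
  rw [ENNReal.ofReal_mul toReal_nonneg, ENNReal.ofReal_toReal hCt, ofReal_norm]
  refine (eLpNorm_rpow_sum_antitone ht0 htp _).trans
    ((eLpNorm_map_le_of_weights (by linarith) hr₂₁ T f hP).trans ?_)
  gcongr
  exact eLpNorm_rpow_sum_antitone (by linarith) hqt _
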